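/- Let a, b, c, d, e be complex numbers with Re(e-d) > 0 and Re(d+e-a-b-c) > 0 (and no denominator parameter a nonpositive integer). Then Σ_{m,n≥0} (a)_m(b)_m(c)_m (d-a)_n(d-b)_n(d-c)_n / ((d)_{m+n}(e)_m(d+e-a-b-c)_n m! n!) = Γ(e)Γ(e+d-a-b-c)Γ(e-d) / (Γ(e-a)Γ(e-b)Γ(e-c)). -/

import Mathlib

open Complex Finset

/-- Pochhammer symbol `(a)_k = a(a+1)⋯(a+k-1)`. -/
noncomputable def poch (a : ℂ) (k : ℕ) : ℂ := ∏ i ∈ Finset.range k, (a + i)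

/-- `z` is not a nonpositive integer. -/
def notNonposInt (z : ℂ) : Prop := ∀ k : ℕ, z ≠ -(k : ℂ)

noncomputable def kT (a b c d e : ℂ) (m n : ℕ) : ℂ :=
  poch a m * poch b m * poch c m *
            poch (d - a) n * poch (d - b) n * poch (d - c) n /
          (poch d (m + n) * poch e m * poch (d + e - a - b - c) n *
            (Nat.factorial m : ℂ) * (Nat.factorial n : ℂ))

lemma poch_succ (a : ℂ) (k : ℕ) : poch a (k+1) = poch a k * (a + k) := by
  simp [poch, Finset.prod_range_succ]

lemma poch_zero (a : ℂ) : poch a 0 = 1 := by simp [poch]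

lemma nni_add {z : ℂ} (h : notNonposInt z) (k : ℕ) : z + k ≠ 0 := by
  intro h0
  exact h k (eq_neg_of_add_eq_zero_left h0)

lemma poch_ne {z : ℂ} (h : notNonposInt z) (k : ℕ) : poch z k ≠ 0 :=
  Finset.prod_ne_zero_iff.mpr fun i _ => nni_add h i

lemma nni_of_re {z : ℂ} (h : 0 < z.re) : notNonposInt z := by
  intro k hk
  rw [hk] at h
  simp at h
  have : (0:ℝ) ≤ k := Nat.cast_nonneg k
  linarith

lemma nni_shift {z : ℂ} (h : notNonposInt z) (j : ℕ) : notNonposInt (z + j) := by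
  intro k hk
  apply h (k + j)
  push_cast
  linear_combination hk

lemma poch_shift (z : ℂ) (k : ℕ) : poch (z+1) k * z = poch z k * (z + k) := by
  induction k with
  | zero => simp [poch_zero]
  | succ k ih => 
    rw [poch_succ, poch_succ]
    push_cast
    linear_combination (z + 1 + k) * ih

section rel
variable {a b c d e : ℂ} (hd : notNonposInt d) (he : notNonposInt e)
    (hee : notNonposInt (d + e - a - b - c))

lemma kT_m (a b c d e : ℂ) (hd : notNonposInt d) (he : notNonposInt e)
    (hee : notNonposInt (d + e - a - b - c)) (m n : ℕ) : kT a b c d e (m+1) n =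
    (a+m)*(b+m)*(c+m)/((d+m+n)*(e+m)*(m+1)) * kT a b c d e m n := by
  unfold kT
  have h1 := nni_add hd (m+n)
  have h2 := nni_add he m
  have h3 := poch_ne hd (m+n)
  have h4 := poch_ne he m
  have h5 := poch_ne hee n
  have h6 : (Nat.factorial m : ℂ) ≠ 0 := by exact_mod_cast Nat.factorial_ne_zero m
  have h7 : (Nat.factorial n : ℂ) ≠ 0 := by exact_mod_cast Nat.factorial_ne_zero n
  have h8 : (m + 1 : ℂ) ≠ 0 := by exact_mod_cast Nat.succ_ne_zero m
  rw [show m + 1 + n = (m + n) + 1 by ring, Nat.factorial_succ]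
  simp only [poch_succ]
  push_cast at h1 ⊢
  rw [← add_assoc] at h1 ⊢
  field_simp

lemma kT_n (a b c d e : ℂ) (hd : notNonposInt d) (he : notNonposInt e)
    (hee : notNonposInt (d + e - a - b - c)) (m n : ℕ) : kT a b c d e m (n+1) =
    (d-a+n)*(d-b+n)*(d-c+n)/((d+m+n)*(d+e-a-b-c+n)*(n+1)) * kT a b c d e m n := by
  unfold kT
  have h1 := nni_add hd (m+n)
  have h2 := nni_add hee n
  have h3 := poch_ne hd (m+n)
  have h4 := poch_ne he m
  have h5 := poch_ne hee n
  have h6 : (Nat.factorial m : ℂ) ≠ 0 := by exact_mod_cast Nat.factorial_ne_zero m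
  have h7 : (Nat.factorial n : ℂ) ≠ 0 := by exact_mod_cast Nat.factorial_ne_zero n
  have h8 : (n + 1 : ℂ) ≠ 0 := by exact_mod_cast Nat.succ_ne_zero n
  rw [show m + (n + 1) = (m + n) + 1 by ring, Nat.factorial_succ]
  simp only [poch_succ]
  push_cast at h1 ⊢
  rw [← add_assoc] at h1 ⊢
  generalize d + e - a - b - c = f at *
  field_simp

lemma kT_e (a b c d e : ℂ) (hd : notNonposInt d) (he : notNonposInt e)
    (hee : notNonposInt (d + e - a - b - c)) (m n : ℕ) : kT a b c d (e+1) m n =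
    e * (d+e-a-b-c)/((e+m)*(d+e-a-b-c+n)) * kT a b c d e m n := by
  unfold kT
  rw [show d + (e+1) - a - b - c = (d+e-a-b-c) + 1 by ring]
  have h0 := nni_add he m
  have h2 := nni_add hee n
  have h00 := nni_add he 0
  have h20 := nni_add hee 0
  have h3 := poch_ne hd (m+n)
  have h4 := poch_ne he m
  have h5 := poch_ne hee n
  have h6 : (Nat.factorial m : ℂ) ≠ 0 := by exact_mod_cast Nat.factorial_ne_zero m
  have h7 : (Nat.factorial n : ℂ) ≠ 0 := by exact_mod_cast Nat.factorial_ne_zero n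
  generalize d + e - a - b - c = f at *
  simp only [Nat.cast_zero, add_zero] at h00 h20
  have e1 : poch (e+1) m = poch e m * (e+m) / e := by
    rw [← poch_shift]; field_simp
  have e2 : poch (f+1) n = poch f n * (f+n) / f := by
    rw [← poch_shift]; field_simp
  rw [e1, e2]
  field_simp
end rel

noncomputable def kG (a b c d e : ℂ) (m n : ℕ) : ℂ :=
  m * (n + d - e) / (d + e - a - b - c + n) * kT a b c d e m n

noncomputable def kF (a b c d e : ℂ) (m n : ℕ) : ℂ :=
  (e - d) * kT a b c d e m n -
    (e-a)*(e-b)*(e-c)/(e * (d + e - a - b - c)) * kT a b c d (e+1) m n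

lemma kT_cert (a b c d e : ℂ) (hd : notNonposInt d) (he : notNonposInt e)
    (hee : notNonposInt (d + e - a - b - c)) (m n : ℕ) :
    kF a b c d e m n = (kG a b c d e (m+1) n - kG a b c d e m n)
      + (-((n+1 : ℕ) : ℂ) * kT a b c d e m (n+1) - -(n:ℂ) * kT a b c d e m n) := by
  unfold kF kG
  rw [kT_m a b c d e hd he hee, kT_n a b c d e hd he hee, kT_e a b c d e hd he hee]
  have h1 := nni_add hd (m+n)
  have h0 := nni_add he m
  have h2 := nni_add hee n
  have h00 := nni_add he 0
  have h20 := nni_add hee 0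
  have h8 : (n + 1 : ℂ) ≠ 0 := by exact_mod_cast Nat.succ_ne_zero n
  have h9 : (m + 1 : ℂ) ≠ 0 := by exact_mod_cast Nat.succ_ne_zero m
  generalize kT a b c d e m n = t
  push_cast at h1 ⊢
  rw [← add_assoc] at h1
  simp only [Nat.cast_zero, add_zero] at h00 h20
  obtain ⟨f, hf⟩ : ∃ f, f = d + e - a - b - c := ⟨_, rfl⟩
  rw [← hf] at h2 h20 ⊢
  obtain rfl : a = d + e - f - b - c := by rw [hf]; ring
  field_simp
  ring

lemma tele_zero (x y : ℕ → ℂ) (C : ℝ) (h0 : x 0 = 0)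
    (hs : Summable fun n => x (n+1) - x n) (hy : Summable y)
    (hb : ∀ n, ‖x n‖ ≤ n * (C * ‖y n‖)) : ∑' n, (x (n+1) - x n) = 0 := by
  have ht := hs.hasSum.tendsto_sum_nat
  simp only [Finset.sum_range_sub, h0, sub_zero] at ht
  set L := ∑' n, (x (n+1) - x n)
  by_contra hL
  have hLp : 0 < ‖L‖ := norm_pos_iff.mpr hL
  have hev : ∀ᶠ n in Filter.atTop, ‖L‖/2 < ‖x n‖ :=
    ht.norm.eventually_const_lt (by linarith)
  have hsum : Summable fun n => (C * ‖y n‖) := (hy.norm).mul_left C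
  have : Summable fun n : ℕ => (‖L‖/2) * (1 / (n:ℝ)) := by
    refine Summable.of_norm_bounded_eventually_nat hsum ?_
    filter_upwards [hev, Filter.eventually_gt_atTop 0] with n hn hn0
    have hn' : (0:ℝ) < n := by exact_mod_cast hn0
    rw [Real.norm_of_nonneg (by positivity), mul_one_div, div_le_iff₀ hn']
    have := hb n
    nlinarith
  rw [summable_mul_left_iff (by positivity)] at this
  exact Real.not_summable_one_div_natCast this

lemma tendsto_inv_add (f : ℂ) :
    Filter.Tendsto (fun n : ℕ => (f + (n:ℂ))⁻¹) Filter.atTop (nhds 0) :=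
  Filter.tendsto_inv₀_cobounded.comp
    ((tendsto_const_add_cobounded f).comp (tendsto_natCast_atTop_cobounded (α := ℂ)))

lemma ev_add_ne (f : ℂ) : ∀ᶠ n : ℕ in Filter.atTop, f + (n:ℂ) ≠ 0 := 
  ((tendsto_const_add_cobounded f).comp
    (tendsto_natCast_atTop_cobounded (α := ℂ))).eventually (Bornology.eventually_ne_cobounded 0)

lemma ratio_tendsto (u f : ℂ) :
    Filter.Tendsto (fun n : ℕ => ((n:ℂ) + u) / (f + n)) Filter.atTop (nhds 1) := by
  have h1 : Filter.Tendsto (fun n : ℕ => (u - f) * (f + n)⁻¹ + 1) Filter.atTop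
      (nhds ((u - f) * 0 + 1)) := ((tendsto_inv_add f).const_mul _).add_const 1
  rw [mul_zero, zero_add] at h1
  refine h1.congr' ?_
  filter_upwards [ev_add_ne f] with n hn
  field_simp
  ring

lemma bdd_ratio (d e f : ℂ) :
    ∃ C : ℝ, ∀ n : ℕ, ‖((n:ℂ) + d - e) / (f + n)‖ ≤ C := by
  obtain ⟨C, hC⟩ := (ratio_tendsto (d - e) f).norm.bddAbove_range
  refine ⟨C, fun n => ?_⟩
  rw [add_sub_assoc]
  exact hC ⟨n, rfl⟩

lemma rec_S (a b c d e : ℂ) (hd : notNonposInt d) (he : notNonposInt e)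
    (hee : notNonposInt (d + e - a - b - c))
    (hs : Summable fun p : ℕ × ℕ => kT a b c d e p.1 p.2)
    (hs1 : Summable fun p : ℕ × ℕ => kT a b c d (e+1) p.1 p.2) :
    (e - d) * ∑' p : ℕ × ℕ, kT a b c d e p.1 p.2 =
      (e-a)*(e-b)*(e-c)/(e * (d + e - a - b - c)) *
        ∑' p : ℕ × ℕ, kT a b c d (e+1) p.1 p.2 := by
  have hF : Summable fun p : ℕ × ℕ => kF a b c d e p.1 p.2 :=
    (hs.mul_left _).sub (hs1.mul_left _)
  rw [← sub_eq_zero, ← tsum_mul_left, ← tsum_mul_left,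
    ← (hs.mul_left _).tsum_sub (hs1.mul_left _)]
  change ∑' p : ℕ × ℕ, kF a b c d e p.1 p.2 = 0
  rw [hF.tsum_prod]
  obtain ⟨C, hC⟩ := bdd_ratio d e (d + e - a - b - c)
  have hC0 : 0 ≤ C := (norm_nonneg _).trans (hC 0)
  have hGb : ∀ m n, ‖kG a b c d e m n‖ ≤ (m * C) * ‖kT a b c d e m n‖ := by
    intro m n
    unfold kG
    rw [mul_div_assoc, norm_mul, norm_mul, Complex.norm_natCast]
    gcongr
    exact hC n
  have hTm : ∀ m, Summable fun n => kT a b c d e m n := fun m => hs.prod_factor m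
  have hGm : ∀ m, Summable fun n => kG a b c d e m n := fun m =>
    Summable.of_norm_bounded ((hTm m).norm.mul_left (m * C)) (hGb m)
  have hin : ∀ m, ∑' n, kF a b c d e m n =
      (∑' n, kG a b c d e (m+1) n) - ∑' n, kG a b c d e m n := by
    intro m
    have hFm : Summable fun n => kF a b c d e m n := hF.prod_factor m
    have hd1 := (hGm (m+1)).sub (hGm m)
    have hx : ∀ n, (-((n+1 : ℕ) : ℂ) * kT a b c d e m (n+1) - -(n:ℂ) * kT a b c d e m n)
       = kF a b c d e m n - (kG a b c d e (m+1) n - kG a b c d e m n) := by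
      intro n
      rw [kT_cert a b c d e hd he hee]
      ring
    have hz := tele_zero (fun n => -(n:ℂ) * kT a b c d e m n) (kT a b c d e m) 1 (by simp)
      (by
        refine (hFm.sub hd1).congr fun n => ?_
        exact (hx n).symm) (hTm m) (by intro n; simp)
    simp only [hx] at hz
    rw [hFm.tsum_sub hd1, (hGm (m+1)).tsum_sub (hGm m)] at hz
    exact sub_eq_zero.mp hz
  simp only [hin]
  refine tele_zero (fun m => ∑' n, kG a b c d e m n) 
    (fun m => ((∑' n, ‖kT a b c d e m n‖ : ℝ) : ℂ)) C (by simp [kG]) ?_ ?_ ?_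
  · have := hF.prod
    simpa only [hin] using this
  · have := hs.norm.prod
    exact_mod_cast this
  · intro m
    rw [Complex.norm_real, Real.norm_of_nonneg (tsum_nonneg fun _ => norm_nonneg _), ← mul_assoc,
      ← tsum_mul_left]
    exact tsum_of_norm_bounded ((hTm m).norm.mul_left (m * C)).hasSum (hGb m)

lemma gammaSeq_inv_tendsto (s : ℂ) :
    Filter.Tendsto (fun n => (GammaSeq s n)⁻¹) Filter.atTop (nhds (Gamma s)⁻¹) := by
  by_cases hs : notNonposInt s
  · exact (GammaSeq_tendsto_Gamma s).inv₀ (Gamma_ne_zero hs)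
  · simp only [notNonposInt, not_forall, not_not] at hs
    obtain ⟨k, rfl⟩ := hs
    rw [Gamma_neg_nat_eq_zero, inv_zero]
    refine tendsto_const_nhds.congr' ?_
    filter_upwards [Filter.eventually_ge_atTop k] with n hn
    have : ∏ j ∈ Finset.range (n+1), (-(k:ℂ) + j) = 0 :=
      Finset.prod_eq_zero (Finset.mem_range.mpr (Nat.lt_succ_of_le hn)) (by simp)
    simp [GammaSeq, this]

lemma poch_gammaSeq (x : ℂ) (n : ℕ) (hn : n ≠ 0) :
    poch x (n+1) = (n:ℂ)^x * (n.factorial : ℂ) * (GammaSeq x n)⁻¹ := by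
  have h1 : (n.factorial : ℂ) ≠ 0 := by exact_mod_cast n.factorial_ne_zero
  have h2 : (n:ℂ)^x ≠ 0 := by
    rw [Ne, Complex.cpow_eq_zero_iff]
    simp [hn]
  simp only [poch, GammaSeq, inv_div]
  field_simp

lemma poch_tendsto (x : ℂ) :
    Filter.Tendsto (fun m : ℕ => ‖poch x m‖ / (m.factorial * ((m:ℝ)+1)^(x.re - 1)))
      Filter.atTop (nhds ‖(Gamma x)⁻¹‖) := by
  have h1 := (gammaSeq_inv_tendsto x).norm
  have h2 : Filter.Tendsto (fun m : ℕ => ((m:ℝ)/((m:ℝ)+1))^x.re) Filter.atTop (nhds 1) := by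
    have := (tendsto_natCast_div_add_atTop (1:ℝ)).rpow_const (p := x.re) (Or.inl one_ne_zero)
    simpa using this
  have h3 := (ratio_tendsto 1 x).norm
  have h4 := h1.mul (h2.mul h3)
  simp only [norm_one, mul_one] at h4
  refine h4.congr' ?_
  filter_upwards [ev_add_ne x, Filter.eventually_gt_atTop 0] with m hm hm0
  have e1 := poch_gammaSeq x m hm0.ne'
  rw [poch_succ] at e1
  have e2 := congrArg norm e1
  rw [norm_mul, norm_mul, norm_mul, Complex.norm_natCast_cpow_of_pos hm0, Complex.norm_natCast] at e2
  have hm' : (0:ℝ) < m := by exact_mod_cast hm0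
  have hn : 0 < ‖x + m‖ := norm_pos_iff.mpr hm
  have e3 : ‖(m:ℂ) + 1‖ = (m:ℝ) + 1 := by
    have := Complex.norm_natCast (m+1)
    push_cast at this
    exact this
  have hf : (0:ℝ) < m.factorial := by exact_mod_cast m.factorial_pos
  rw [norm_div, e3, Real.div_rpow hm'.le (by positivity), Real.rpow_sub (by positivity), Real.rpow_one]
  have hp : 0 < ((m:ℝ)+1)^x.re := by positivity
  generalize ‖(x.GammaSeq m)⁻¹‖ = g at *
  field_simp
  linarith [e2]

lemma poch_upper (x : ℂ) : ∃ C : ℝ, 0 ≤ C ∧ ∀ m : ℕ,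
    ‖poch x m‖ ≤ C * (m.factorial * ((m:ℝ)+1)^(x.re - 1)) := by
  obtain ⟨C, hC⟩ := (poch_tendsto x).bddAbove_range
  have h : ∀ m : ℕ, ‖poch x m‖ / (m.factorial * ((m:ℝ)+1)^(x.re - 1)) ≤ C := fun m => hC ⟨m, rfl⟩
  refine ⟨C, le_trans (by positivity) (h 0), fun m => ?_⟩
  have := h m
  rwa [div_le_iff₀ (by positivity)] at this

lemma poch_lower (x : ℂ) (hx : notNonposInt x) : ∃ C : ℝ, 0 ≤ C ∧ ∀ m : ℕ,
    ‖poch x m‖⁻¹ ≤ C * (m.factorial * ((m:ℝ)+1)^(x.re - 1))⁻¹ := by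
  have h0 : ‖(Gamma x)⁻¹‖ ≠ 0 := norm_ne_zero_iff.mpr (inv_ne_zero (Gamma_ne_zero hx))
  obtain ⟨C, hC⟩ := ((poch_tendsto x).inv₀ h0).bddAbove_range
  have h : ∀ m : ℕ, (‖poch x m‖ / (m.factorial * ((m:ℝ)+1)^(x.re - 1)))⁻¹ ≤ C :=
    fun m => hC ⟨m, rfl⟩
  refine ⟨C, le_trans (by positivity) (h 0), fun m => ?_⟩
  have h1 := h m
  have h2 : 0 < (m.factorial * ((m:ℝ)+1)^(x.re - 1)) := by positivity
  rw [inv_div, div_eq_mul_inv] at h1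
  rw [← div_eq_mul_inv, le_div_iff₀ h2]
  linarith

lemma fact_bound (m n : ℕ) (h : n ≤ m) : 2^n * (m.factorial * n.factorial) ≤ (m+n).factorial := by
  induction n with
  | zero => simp
  | succ n ih =>
    have := ih (by omega)
    rw [← add_assoc, Nat.factorial_succ (m+n), Nat.factorial_succ n, pow_succ]
    calc 2^n*2*(m.factorial * ((n+1) * n.factorial)) 
        = (2*(n+1)) * (2^n * (m.factorial * n.factorial)) := by ring
      _ ≤ (m+n+1) * (m+n).factorial := Nat.mul_le_mul (by omega) this

lemma fact_bound' (m n : ℕ) (h : n ≤ m) :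
    (m.factorial * n.factorial : ℝ) / (m+n).factorial ≤ (1/2)^n := by
  have h1 : (0:ℝ) < (m+n).factorial := by positivity
  have h2 : (2^n * (m.factorial * n.factorial) : ℝ) ≤ (m+n).factorial := by
    exact_mod_cast fact_bound m n h
  rw [div_le_iff₀ h1, one_div, inv_pow, inv_mul_eq_div, le_div_iff₀ (by positivity)]
  linarith

lemma K_bound (s M K : ℝ) (hM : 0 < M) (h1 : M ≤ K) (h2 : K ≤ 2*M) :
    K^s ≤ 2^|s| * M^s := by
  rcases le_total 0 s with h | h
  · rw [abs_of_nonneg h, ← Real.mul_rpow (by norm_num) hM.le]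
    exact Real.rpow_le_rpow (by linarith) h2 h
  · have h3 : K^s ≤ M^s := Real.rpow_le_rpow_of_nonpos hM h1 h
    have h4 : (1:ℝ) ≤ 2^|s| := Real.one_le_rpow (by norm_num) (abs_nonneg s)
    have h5 : 0 < M^s := by positivity
    nlinarith

lemma summ_geo (B : ℝ) : Summable fun n : ℕ => ((n:ℝ)+1)^B * (1/2:ℝ)^n := by
  have h1 := summable_pow_mul_geometric_of_norm_lt_one (R := ℝ) ⌈B⌉₊ (r := 1/2) (by norm_num)
  have h2 := ((summable_nat_add_iff 1).mpr h1).mul_left 2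
  refine Summable.of_nonneg_of_le (fun n => by positivity) (fun n => ?_) h2
  have : ((n:ℝ)+1)^B ≤ ((n:ℝ)+1)^⌈B⌉₊ := by
    rw [← Real.rpow_natCast]
    exact Real.rpow_le_rpow_of_exponent_le (by linarith [Nat.cast_nonneg (α := ℝ) n]) (Nat.le_ceil B)
  push_cast
  calc _ ≤ ((n:ℝ)+1)^⌈B⌉₊ * (1/2:ℝ)^n := by gcongr
    _ = _ := by rw [pow_succ]; ring

lemma summ_pow (α : ℝ) (h : 0 < α) : Summable fun n : ℕ => ((n:ℝ)+1)^(-1-α) := by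
  have := (summable_nat_add_iff 1).mpr (Real.summable_nat_rpow.mpr (show -1-α < -1 by linarith))
  simpa using this

/-- The model term. -/
noncomputable def modT (δ α β : ℝ) (m n : ℕ) : ℝ :=
  (m.factorial * n.factorial : ℝ) / (m+n).factorial *
    (((m:ℝ)+1)^(δ-α-2) * ((n:ℝ)+1)^(δ-β-2) * ((m:ℝ)+n+1)^(1-δ))

lemma modT_symm (δ α β : ℝ) (m n : ℕ) : modT δ α β m n = modT δ β α n m := by
  unfold modT
  rw [add_comm m n, add_comm (m:ℝ) n]
  ring

lemma modT_le (δ α β : ℝ) (m n : ℕ) (h : n ≤ m) : modT δ α β m n ≤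
    2^|1-δ| * (((m:ℝ)+1)^(-1-α) * (((n:ℝ)+1)^(δ-β-2) * (1/2)^n)) := by
  have hn : (n:ℝ) ≤ m := by exact_mod_cast h
  have hn0 : (0:ℝ) ≤ n := Nat.cast_nonneg n
  have hM : (0:ℝ) < (m:ℝ)+1 := by positivity
  unfold modT
  have hK := K_bound (1-δ) ((m:ℝ)+1) ((m:ℝ)+n+1) hM (by linarith) (by linarith)
  have hf := fact_bound' m n h
  calc _ ≤ (1/2)^n * (((m:ℝ)+1)^(δ-α-2) * ((n:ℝ)+1)^(δ-β-2) * (2^|1-δ| * ((m:ℝ)+1)^(1-δ))) := by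
        gcongr
    _ = _ := by
        rw [show -1-α = (δ-α-2) + (1-δ) by ring, Real.rpow_add hM]
        ring

lemma modT_summable (δ α β : ℝ) (hα : 0 < α) (hβ : 0 < β) :
    Summable fun p : ℕ × ℕ => modT δ α β p.1 p.2 := by
  have s1 := ((summ_pow α hα).mul_of_nonneg (summ_geo (δ-β-2))
    (fun n => by positivity) (fun n => by positivity)).mul_left (2^|1-δ|)
  have s2 := ((summ_geo (δ-α-2)).mul_of_nonneg (summ_pow β hβ)
    (fun n => by positivity) (fun n => by positivity)).mul_left (2^|1-δ|)
  refine Summable.of_nonneg_of_le (fun p => by unfold modT; positivity) (fun p => ?_) (s1.add s2)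
  obtain ⟨m, n⟩ := p
  rcases le_total n m with h | h
  · refine (modT_le δ α β m n h).trans (le_add_of_nonneg_right ?_)
    positivity
  · rw [modT_symm]
    refine (modT_le δ β α n m h).trans ?_
    refine le_trans (le_of_eq ?_) (le_add_of_nonneg_left ?_)
    · ring
    · positivity

set_option maxHeartbeats 2000000 in
lemma kT_summable (a b c d e : ℂ) (h1 : 0 < (e - d).re) (h2 : 0 < (d + e - a - b - c).re)
    (hd : notNonposInt d) (he : notNonposInt e) :
    Summable fun p : ℕ × ℕ => kT a b c d e p.1 p.2 := by
  obtain ⟨C1, k1, H1⟩ := poch_upper a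
  obtain ⟨C2, k2, H2⟩ := poch_upper b
  obtain ⟨C3, k3, H3⟩ := poch_upper c
  obtain ⟨C4, k4, H4⟩ := poch_upper (d-a)
  obtain ⟨C5, k5, H5⟩ := poch_upper (d-b)
  obtain ⟨C6, k6, H6⟩ := poch_upper (d-c)
  obtain ⟨C7, k7, H7⟩ := poch_lower d hd
  obtain ⟨C8, k8, H8⟩ := poch_lower e he
  obtain ⟨C9, k9, H9⟩ := poch_lower _ (nni_of_re h2)
  refine Summable.of_norm_bounded ((modT_summable d.re _ _ h2 h1).mul_left
    (C1*C2*C3*C4*C5*C6*(C7*C8*C9))) ?_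
  rintro ⟨m, n⟩
  dsimp only
  have hm : (0:ℝ) < m.factorial := by positivity
  have hn : (0:ℝ) < n.factorial := by positivity
  have hmn : (0:ℝ) < (m+n).factorial := by positivity
  have hM : (0:ℝ) < (m:ℝ)+1 := by positivity
  have hN : (0:ℝ) < (n:ℝ)+1 := by positivity
  have hK : (0:ℝ) < (m:ℝ)+n+1 := by positivity
  have E : ‖kT a b c d e m n‖ = ‖poch a m‖ * ‖poch b m‖ * ‖poch c m‖ * ‖poch (d-a) n‖ *
     ‖poch (d-b) n‖ * ‖poch (d-c) n‖ * (‖poch d (m+n)‖⁻¹ * ‖poch e m‖⁻¹ *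
      ‖poch (d+e-a-b-c) n‖⁻¹ * (m.factorial:ℝ)⁻¹ * (n.factorial:ℝ)⁻¹) := by
    unfold kT
    simp only [norm_inv, norm_mul, Complex.norm_natCast, div_eq_mul_inv, mul_inv]
  have H7' := H7 (m+n)
  push_cast at H7'
  rw [E]
  calc _ ≤ (C1 * (m.factorial * ((m:ℝ)+1)^(a.re - 1))) *
        (C2 * (m.factorial * ((m:ℝ)+1)^(b.re - 1))) *
        (C3 * (m.factorial * ((m:ℝ)+1)^(c.re - 1))) *
        (C4 * (n.factorial * ((n:ℝ)+1)^((d-a).re - 1))) *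
        (C5 * (n.factorial * ((n:ℝ)+1)^((d-b).re - 1))) *
        (C6 * (n.factorial * ((n:ℝ)+1)^((d-c).re - 1))) *
        ((C7 * ((m+n).factorial * ((m:ℝ)+n+1)^(d.re - 1))⁻¹) *
        (C8 * (m.factorial * ((m:ℝ)+1)^(e.re - 1))⁻¹) *
        (C9 * (n.factorial * ((n:ℝ)+1)^((d+e-a-b-c).re - 1))⁻¹) *
        (m.factorial:ℝ)⁻¹ * (n.factorial:ℝ)⁻¹) := by
        gcongr
        · exact H1 m
        · exact H2 m
        · exact H3 m
        · exact H4 n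
        · exact H5 n
        · exact H6 n
        · exact H8 m
        · exact H9 n
    _ = _ := by
        unfold modT
        simp only [Complex.sub_re, Complex.add_re]
        simp only [Real.rpow_sub hM, Real.rpow_sub hN, Real.rpow_sub hK, Real.rpow_add hM,
          Real.rpow_add hN, Real.rpow_one, Real.rpow_two]
        obtain ⟨u0, hu0⟩ : ∃ u, u = ((m:ℝ)+1)^a.re := ⟨_, rfl⟩
        have pu0 : u0 ≠ 0 := by rw [hu0]; positivity
        obtain ⟨u1, hu1⟩ : ∃ u, u = ((m:ℝ)+1)^b.re := ⟨_, rfl⟩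
        have pu1 : u1 ≠ 0 := by rw [hu1]; positivity
        obtain ⟨u2, hu2⟩ : ∃ u, u = ((m:ℝ)+1)^c.re := ⟨_, rfl⟩
        have pu2 : u2 ≠ 0 := by rw [hu2]; positivity
        obtain ⟨u3, hu3⟩ : ∃ u, u = ((m:ℝ)+1)^d.re := ⟨_, rfl⟩
        have pu3 : u3 ≠ 0 := by rw [hu3]; positivity
        obtain ⟨u4, hu4⟩ : ∃ u, u = ((m:ℝ)+1)^e.re := ⟨_, rfl⟩
        have pu4 : u4 ≠ 0 := by rw [hu4]; positivity
        obtain ⟨u5, hu5⟩ : ∃ u, u = ((n:ℝ)+1)^a.re := ⟨_, rfl⟩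
        have pu5 : u5 ≠ 0 := by rw [hu5]; positivity
        obtain ⟨u6, hu6⟩ : ∃ u, u = ((n:ℝ)+1)^b.re := ⟨_, rfl⟩
        have pu6 : u6 ≠ 0 := by rw [hu6]; positivity
        obtain ⟨u7, hu7⟩ : ∃ u, u = ((n:ℝ)+1)^c.re := ⟨_, rfl⟩
        have pu7 : u7 ≠ 0 := by rw [hu7]; positivity
        obtain ⟨u8, hu8⟩ : ∃ u, u = ((n:ℝ)+1)^d.re := ⟨_, rfl⟩
        have pu8 : u8 ≠ 0 := by rw [hu8]; positivity
        obtain ⟨u9, hu9⟩ : ∃ u, u = ((n:ℝ)+1)^e.re := ⟨_, rfl⟩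
        have pu9 : u9 ≠ 0 := by rw [hu9]; positivity
        obtain ⟨u10, hu10⟩ : ∃ u, u = ((m:ℝ)+n+1)^d.re := ⟨_, rfl⟩
        have pu10 : u10 ≠ 0 := by rw [hu10]; positivity
        simp only [← hu0, ← hu1, ← hu2, ← hu3, ← hu4, ← hu5, ← hu6, ← hu7, ← hu8, ← hu9, ← hu10]
        clear hu0 hu1 hu2 hu3 hu4 hu5 hu6 hu7 hu8 hu9 hu10 H1 H2 H3 H4 H5 H6 H7 H8 H9 H7' E
        replace hM := hM.ne'
        replace hN := hN.ne'
        replace hK := hK.ne'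
        replace hm := hm.ne'
        replace hn := hn.ne'
        replace hmn := hmn.ne'
        generalize (m:ℝ)+n+1 = K at *
        generalize (m:ℝ)+1 = M at *
        generalize (n:ℝ)+1 = N at *
        generalize (m.factorial:ℝ) = x at *
        generalize (n.factorial:ℝ) = y at *
        generalize ((m+n).factorial:ℝ) = z at *
        field_simp
        

lemma inv_poch_tendsto (z : ℂ) (m : ℕ) : Filter.Tendsto (fun N : ℕ => (poch (z+N) m)⁻¹)
    Filter.atTop (nhds (if m = 0 then 1 else 0)) := by
  induction m with
  | zero => simp [poch_zero]
  | succ m ih =>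
    have := ih.mul (tendsto_inv_add (z + m))
    simp only [mul_zero] at this
    simp only [Nat.succ_ne_zero, if_false]
    refine this.congr fun N => ?_
    rw [poch_succ, mul_inv, add_right_comm]

lemma poch_norm_mono (z : ℂ) (N m : ℕ) (h : 0 ≤ 2 * z.re + N) :
    ‖poch z m‖ ≤ ‖poch (z+N) m‖ := by
  unfold poch
  rw [norm_prod, norm_prod]
  refine Finset.prod_le_prod (fun _ _ => norm_nonneg _) fun i _ => ?_
  rw [Complex.norm_def, Complex.norm_def]
  refine Real.sqrt_le_sqrt ?_
  simp only [Complex.normSq_apply, Complex.add_re, Complex.natCast_re, Complex.add_im,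
    Complex.natCast_im, add_zero]
  have h1 : (0:ℝ) ≤ N := Nat.cast_nonneg N
  have h2 : (0:ℝ) ≤ i := Nat.cast_nonneg i
  nlinarith [mul_nonneg h1 h, mul_nonneg h1 h2]

lemma S_tendsto (a b c d e : ℂ) (h1 : 0 < (e - d).re) (h2 : 0 < (d + e - a - b - c).re)
    (hd : notNonposInt d) (he : notNonposInt e) :
    Filter.Tendsto (fun N : ℕ => ∑' p : ℕ × ℕ, kT a b c d (e+N) p.1 p.2) Filter.atTop (nhds 1) := by
  have hee := nni_of_re h2
  have E : ∀ (N : ℕ) m n, kT a b c d (e+N) m n =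
      (poch a m * poch b m * poch c m * poch (d - a) n * poch (d - b) n * poch (d - c) n /
        (poch d (m+n) * m.factorial * n.factorial)) * ((poch (e+N) m)⁻¹ *
          (poch (d+e-a-b-c+N) n)⁻¹) := by
    intro N m n
    unfold kT
    rw [show d + (e+N) - a - b - c = d+e-a-b-c+N by ring]
    simp only [div_eq_mul_inv, mul_inv]
    ring
  have key : Filter.Tendsto (fun N : ℕ => ∑' p : ℕ × ℕ, kT a b c d (e+N) p.1 p.2) Filter.atTop
      (nhds (∑' p : ℕ × ℕ, if p = (0,0) then (1:ℂ) else 0)) := by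
    refine tendsto_tsum_of_dominated_convergence (kT_summable a b c d e h1 h2 hd he).norm ?_ ?_
    · rintro ⟨m, n⟩
      simp only [E]
      have := ((inv_poch_tendsto e m).mul (inv_poch_tendsto (d+e-a-b-c) n)).const_mul
        (poch a m * poch b m * poch c m * poch (d - a) n * poch (d - b) n * poch (d - c) n /
        (poch d (m+n) * m.factorial * n.factorial))
      convert this using 2
      rcases m with _ | m <;> rcases n with _ | n <;> simp [poch_zero]
    · filter_upwards [Filter.eventually_ge_atTop ⌈-(2*e.re)⌉₊] with N hN
      rintro ⟨m, n⟩
      have hN' : -(2*e.re) ≤ N := Nat.ceil_le.mp hN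
      have q1 := poch_norm_mono e N m (by linarith)
      have q2 := poch_norm_mono (d+e-a-b-c) N n
        (by have : (0:ℝ) ≤ N := Nat.cast_nonneg N
            linarith)
      have E0 := E 0 m n
      simp only [Nat.cast_zero, add_zero] at E0
      dsimp only
      rw [E N, E0, norm_mul, norm_mul, norm_mul, norm_mul, norm_inv, norm_inv, norm_inv, norm_inv]
      have p1 := norm_pos_iff.mpr (poch_ne he m)
      have p2 := norm_pos_iff.mpr (poch_ne hee n)
      gcongr
  simpa using key

lemma S_iter (a b c d e : ℂ) (h1 : 0 < (e - d).re) (h2 : 0 < (d + e - a - b - c).re)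
    (hd : notNonposInt d) (he : notNonposInt e) (N : ℕ) :
    ∑' p : ℕ × ℕ, kT a b c d e p.1 p.2 =
      poch (e-a) N * poch (e-b) N * poch (e-c) N / (poch e N * poch (d+e-a-b-c) N * poch (e-d) N)
       * ∑' p : ℕ × ℕ, kT a b c d (e+N) p.1 p.2 := by
  induction N with
  | zero => simp [poch_zero]
  | succ N ih =>
    have hN : (0:ℝ) ≤ N := Nat.cast_nonneg N
    have g1 : 0 < (e + N - d).re := by
      simp at h1 ⊢; linarith
    have g2 : 0 < (d + (e + N) - a - b - c).re := by
      simp at h2 ⊢; linarith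
    have g1' : 0 < (e + N + 1 - d).re := by
      simp at h1 ⊢; linarith
    have g2' : 0 < (d + (e + N + 1) - a - b - c).re := by
      simp at h2 ⊢; linarith
    have heN := nni_shift he N
    have heN1 : notNonposInt (e + N + 1) := by
      have := nni_shift heN 1
      simpa using this
    have r := rec_S a b c d (e+N) hd heN (nni_of_re g2) (kT_summable a b c d _ g1 g2 hd heN)
      (kT_summable a b c d _ g1' g2' hd heN1)
    have z1 := nni_add (nni_of_re g1) 0
    simp only [Nat.cast_zero, add_zero] at z1
    have r2 : ∑' p : ℕ × ℕ, kT a b c d (e+N) p.1 p.2 = 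
      (e+N-a)*(e+N-b)*(e+N-c)/((e+N) * (d + (e+N) - a - b - c)) *
        (∑' p : ℕ × ℕ, kT a b c d (e+N+1) p.1 p.2) / (e + N - d) := by
      rw [← r, mul_div_cancel_left₀ _ z1]
    rw [ih, r2]
    simp only [poch_succ]
    push_cast
    rw [← add_assoc e (N:ℂ) 1]
    rw [show e - a + N = e + N - a by ring, show e - b + N = e + N - b by ring,
      show e - c + N = e + N - c by ring, show e - d + N = e + N - d by ring,
      show d + e - a - b - c + N = d + (e + N) - a - b - c by ring]
    simp only [div_eq_mul_inv, mul_inv]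
    ring

lemma ratio_lim (a b c d e : ℂ) :
    Filter.Tendsto (fun N : ℕ => poch (e-a) (N+1) * poch (e-b) (N+1) * poch (e-c) (N+1) /
      (poch e (N+1) * poch (d+e-a-b-c) (N+1) * poch (e-d) (N+1))) Filter.atTop
      (nhds (Gamma e * Gamma (d+e-a-b-c) * Gamma (e-d) /
        (Gamma (e-a) * Gamma (e-b) * Gamma (e-c)))) := by
  have t := (((GammaSeq_tendsto_Gamma e).mul (GammaSeq_tendsto_Gamma (d+e-a-b-c))).mul
    (GammaSeq_tendsto_Gamma (e-d))).mul (((gammaSeq_inv_tendsto (e-a)).mul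
      (gammaSeq_inv_tendsto (e-b))).mul (gammaSeq_inv_tendsto (e-c)))
  rw [← mul_inv, ← mul_inv, ← div_eq_mul_inv] at t
  refine t.congr' ?_
  filter_upwards [Filter.eventually_gt_atTop 0] with n hn
  have hn' : (n:ℂ) ≠ 0 := by exact_mod_cast hn.ne'
  simp only [poch_gammaSeq _ n hn.ne']
  have hf : (n.factorial : ℂ) ≠ 0 := by exact_mod_cast n.factorial_ne_zero
  have hp : ∀ x : ℂ, (n:ℂ)^x ≠ 0 := fun x => by
    rw [Ne, Complex.cpow_eq_zero_iff]; simp [hn']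
  have key : (n:ℂ)^(e-a) * (n:ℂ)^(e-b) * (n:ℂ)^(e-c) =
      (n:ℂ)^e * (n:ℂ)^(d+e-a-b-c) * (n:ℂ)^(e-d) := by
    simp only [← Complex.cpow_add _ _ hn']
    congr 1
    ring
  have q1 := hp e
  have q2 := hp (d+e-a-b-c)
  have q3 := hp (e-d)
  rw [show ∀ x1 x2 x3 y1 y2 y3 f : ℂ, x1*f*y1*(x2*f*y2)*(x3*f*y3) = (x1*x2*x3)*(f*f*f)*(y1*y2*y3)
    from fun _ _ _ _ _ _ _ => by ring, key]
  rw [show ∀ x1 x2 x3 y1 y2 y3 f : ℂ, x1*f*y1*(x2*f*y2)*(x3*f*y3) = (x1*x2*x3)*(f*f*f)*(y1*y2*y3)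
    from fun _ _ _ _ _ _ _ => by ring]
  rw [mul_div_mul_left _ _ (by positivity)]
  simp only [div_eq_mul_inv, mul_inv, inv_inv]
  ring

theorem kdf_summation_res2 (a b c d e : ℂ)
    (h1 : 0 < (e - d).re) (h2 : 0 < (d + e - a - b - c).re)
    (hd : notNonposInt d) (he : notNonposInt e)
    (hee : notNonposInt (d + e - a - b - c)) :
    (∑' (m : ℕ) (n : ℕ),
        poch a m * poch b m * poch c m *
            poch (d - a) n * poch (d - b) n * poch (d - c) n /
          (poch d (m + n) * poch e m * poch (d + e - a - b - c) n *
            (Nat.factorial m : ℂ) * (Nat.factorial n : ℂ))) =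
      Complex.Gamma e * Complex.Gamma (e + d - a - b - c) * Complex.Gamma (e - d) /
        (Complex.Gamma (e - a) * Complex.Gamma (e - b) * Complex.Gamma (e - c)) := by
  have hs := kT_summable a b c d e h1 h2 hd he
  have e1 : ∑' p : ℕ × ℕ, kT a b c d e p.1 p.2 = _ := hs.tsum_prod
  change ∑' (m : ℕ) (n : ℕ), kT a b c d e m n = _
  rw [← e1, add_comm e d]
  have t1 := (ratio_lim a b c d e).mul
    ((S_tendsto a b c d e h1 h2 hd he).comp (Filter.tendsto_add_atTop_nat 1))
  rw [mul_one] at t1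
  refine tendsto_nhds_unique (tendsto_const_nhds (x := ∑' p : ℕ × ℕ, kT a b c d e p.1 p.2)
    (f := Filter.atTop)) (t1.congr fun N => ?_)
  exact (S_iter a b c d e h1 h2 hd he (N+1)).symm
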